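/- arXiv:1607.08729 — 7 statements merged into one kernel-verified Lean document; each statement's English description precedes it below -/
import Mathlib

section
/- Resultant force under linear-pendulum mode: let m > 0, g > 0, n = (0, 0, 1) ∈ ℝ³, and p_G = (x_G, y_G, z_G) ∈ ℝ³ with z_G ≠ 0. Let f ∈ ℝ³ satisfy n ⬝ f = m g, let τ_O = p_G × f, and define the ZMP p_Z = (x_Z, y_Z, z_Z) := (n × τ_O) / (n ⬝ f). Then z_Z = 0, and setting h := z_Z − z_G = −z_G one has f = ((m g / h)(x_Z − x_G), (m g / h)(y_Z − y_G), m g). -/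
open Matrix

/-- Resultant force under linear-pendulum mode: with `n = (0,0,1)`,
`n ⬝ f = m g`, `τ_O = p_G × f` and ZMP `p_Z = (n × τ_O)/(n ⬝ f)`, one has
`z_Z = 0`, and with `h := z_Z − z_G = −z_G`,
`f = ((m g / h)(x_Z − x_G), (m g / h)(y_Z − y_G), m g)`. -/
theorem linear_pendulum_resultant_force
    (m g : ℝ) (hm : 0 < m) (hg : 0 < g)
    (pG f : Fin 3 → ℝ) (hzG : pG 2 ≠ 0)
    (hf : (![0, 0, 1] : Fin 3 → ℝ) ⬝ᵥ f = m * g) :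
    let n : Fin 3 → ℝ := ![0, 0, 1]
    let τO : Fin 3 → ℝ := crossProduct pG f
    let pZ : Fin 3 → ℝ := (n ⬝ᵥ f)⁻¹ • crossProduct n τO
    let h : ℝ := pZ 2 - pG 2
    pZ 2 = 0 ∧ h = -pG 2 ∧
      f = ![m * g / h * (pZ 0 - pG 0), m * g / h * (pZ 1 - pG 1), m * g] := by
  have hf2 : f 2 = m * g := by simpa [dotProduct, Fin.sum_univ_three] using hf
  have hm0 : m ≠ 0 := hm.ne'
  have hg0 : g ≠ 0 := hg.ne'
  intro n τO pZ h
  have hpZ : pZ = ![(m * g)⁻¹ * (pG 0 * f 2 - pG 2 * f 0),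
      (m * g)⁻¹ * (pG 1 * f 2 - pG 2 * f 1), 0] := by
    simp only [pZ, τO, n, hf, cross_apply]
    ext i
    fin_cases i <;> simp
  have hpZ2 : pZ 2 = 0 := by simp [hpZ]
  have hh : h = -pG 2 := by simp [h, hpZ2]
  refine ⟨hpZ2, hh, ?_⟩
  rw [hh, hpZ]
  ext i
  fin_cases i
  · simp only [Fin.zero_eta, Matrix.cons_val_zero, hf2]
    field_simp
    ring
  · simp only [Fin.mk_one, Matrix.cons_val_zero, Matrix.cons_val_one, hf2]
    field_simp
    ring
  · simpa using hf2
end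

section
/- Polar form of the COM-acceleration constraint: with the notation of the preceding context, suppose σ > 0 and u_z > −g. Then the constraint (a_O + a × p) ⬝ (u − ĝ) ≤ 0 holds if and only if (a_i / σ) · (u_x / (g + u_z)) + (b_i / σ) · (u_y / (g + u_z)) ≤ 1. -/
open Matrix

/-- Polar form of the COM-acceleration constraint: with `gvec = (0,0,−g)`,
`σ := −a_{Oz} + a_y x − a_x y > 0`, `a_i := a_{Ox} + a_y z − a_z y`,
`b_i := a_{Oy} − a_x z + a_z x` and `u_z > −g`, one has
`(a_O + a × p) ⬝ (u − gvec) ≤ 0 ↔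
 (a_i/σ)(u_x/(g+u_z)) + (b_i/σ)(u_y/(g+u_z)) ≤ 1`. -/
theorem com_acceleration_constraint_polar_form
    (aO a p u : Fin 3 → ℝ) (g : ℝ) (hg : 0 < g)
    (hσ : 0 < -aO 2 + a 1 * p 0 - a 0 * p 1)
    (huz : -g < u 2) :
    let gvec : Fin 3 → ℝ := ![0, 0, -g]
    let σ : ℝ := -aO 2 + a 1 * p 0 - a 0 * p 1
    let ai : ℝ := aO 0 + a 1 * p 2 - a 2 * p 1
    let bi : ℝ := aO 1 - a 0 * p 2 + a 2 * p 0
    ((aO + crossProduct a p) ⬝ᵥ (u - gvec) ≤ 0 ↔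
      (ai / σ) * (u 0 / (g + u 2)) + (bi / σ) * (u 1 / (g + u 2)) ≤ 1) := by
  intro gvec σ ai bi
  have hσ' : 0 < σ := hσ
  have hgu : 0 < g + u 2 := by linarith
  have hdot : (aO + crossProduct a p) ⬝ᵥ (u - gvec) =
      ai * u 0 + bi * u 1 - σ * (g + u 2) := by
    simp [gvec, σ, ai, bi, cross_apply, dotProduct, Fin.sum_univ_three]
    ring
  rw [hdot, sub_nonpos, div_mul_div_comm, div_mul_div_comm, ← add_div,
    div_le_one (mul_pos hσ' hgu)]
end

section
/- The COM-acceleration cone points upward: let A be a nonempty finite set of pairs (a_O, a) ∈ ℝ³ × ℝ³, g > 0, ĝ = (0, 0, −g), and p ∈ ℝ³. Assume σ_â(p) > 0 for every â ∈ A, and assume the planar coefficient vectors positively span ℝ², i.e., for every nonzero (v₁, v₂) ∈ ℝ² there exists â ∈ A with a_i(â, p) v₁ + b_i(â, p) v₂ > 0. Then every u = (u_x, u_y, u_z) ∈ C(p) satisfies u_z ≥ −g. -/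
open Matrix

/-- The set of contact-stable COM accelerations at COM position `p` under
zero angular momentum. -/
def comAccelSet (A : Finset ((Fin 3 → ℝ) × (Fin 3 → ℝ))) (g : ℝ)
    (p : Fin 3 → ℝ) : Set (Fin 3 → ℝ) :=
  {u | ∀ aa ∈ A, (aa.1 + crossProduct aa.2 p) ⬝ᵥ (u - ![0, 0, -g]) ≤ 0}

/-- Slackness `σ_â(p) = −a_{Oz} + a_y x − a_x y`. -/
def slackness (aa : (Fin 3 → ℝ) × (Fin 3 → ℝ)) (p : Fin 3 → ℝ) : ℝ :=
  -aa.1 2 + aa.2 1 * p 0 - aa.2 0 * p 1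

/-- Coefficient `a_i(â, p) = a_{Ox} + a_y z − a_z y`. -/
def acoef (aa : (Fin 3 → ℝ) × (Fin 3 → ℝ)) (p : Fin 3 → ℝ) : ℝ :=
  aa.1 0 + aa.2 1 * p 2 - aa.2 2 * p 1

/-- Coefficient `b_i(â, p) = a_{Oy} − a_x z + a_z x`. -/
def bcoef (aa : (Fin 3 → ℝ) × (Fin 3 → ℝ)) (p : Fin 3 → ℝ) : ℝ :=
  aa.1 1 - aa.2 0 * p 2 + aa.2 2 * p 0

/-- Membership in the COM-acceleration set in terms of the planar coefficients and the slackness. -/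
theorem mem_comAccelSet_iff {A : Finset ((Fin 3 → ℝ) × (Fin 3 → ℝ))} {g : ℝ} {p u : Fin 3 → ℝ} :
    u ∈ comAccelSet A g p ↔
      ∀ aa ∈ A, acoef aa p * u 0 + bcoef aa p * u 1 ≤ slackness aa p * (u 2 + g) := by
  refine forall₂_congr fun aa _ => ?_
  rw [← sub_nonpos (a := acoef aa p * u 0 + bcoef aa p * u 1)]
  refine iff_of_eq (congrArg (· ≤ 0) ?_)
  simp [acoef, bcoef, slackness, cross_apply, dotProduct, Fin.sum_univ_three]
  ring

/-- The COM-acceleration cone points upward: if `A` is nonempty,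
`σ_â(p) > 0` for every `â ∈ A`, and the planar coefficient vectors
`(a_i(â,p), b_i(â,p))` positively span `ℝ²`, then every `u ∈ C(p)` satisfies
`u_z ≥ −g`. -/
theorem comAccelSet_points_upward
    (A : Finset ((Fin 3 → ℝ) × (Fin 3 → ℝ))) (hA : A.Nonempty)
    (g : ℝ) (hg : 0 < g) (p : Fin 3 → ℝ)
    (hσ : ∀ aa ∈ A, 0 < slackness aa p)
    (hspan : ∀ v : ℝ × ℝ, v ≠ 0 →
      ∃ aa ∈ A, 0 < acoef aa p * v.1 + bcoef aa p * v.2) :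
    ∀ u ∈ comAccelSet A g p, -g ≤ u 2 := by
  intro u hu
  rw [mem_comAccelSet_iff] at hu
  by_contra! hlt
  have hneg : ∀ aa ∈ A, acoef aa p * u 0 + bcoef aa p * u 1 < 0 := fun aa haa =>
    (hu aa haa).trans_lt (mul_neg_of_pos_of_neg (hσ aa haa) (by linarith))
  by_cases hv : (u 0, u 1) = (0 : ℝ × ℝ)
  · obtain ⟨aa, haa⟩ := hA
    obtain ⟨h0, h1⟩ := Prod.mk.inj hv
    simpa [h0, h1] using hneg aa haa
  · obtain ⟨aa, haa, hpos⟩ := hspan _ hv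
    exact (hneg aa haa).not_gt hpos
end

section
/- (Proposition 1 of the paper.) Interior of the static-equilibrium polygon versus neighborhoods of feasible accelerations: let A be a finite set of pairs (a_O, a) ∈ ℝ³ × ℝ³, g > 0, ĝ = (0, 0, −g), and let p ∈ ℝ³ be such that a_O + a × p ≠ 0 for every (a_O, a) ∈ A. Then σ_â(p) > 0 for every â ∈ A (i.e., the COM lies in the interior of the static-equilibrium polygon) if and only if there exists ε > 0 such that the open ball of radius ε centered at 0 is contained in C(p) (i.e., the set of feasible COM accelerations under zero angular momentum contains a neighborhood of the origin). -/
open Matrix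

/-- The contact constraint at zero angular momentum splits into a linear part in the
acceleration and the slackness. -/
theorem dotProduct_sub_gravity (aa : (Fin 3 → ℝ) × (Fin 3 → ℝ)) (g : ℝ) (p u : Fin 3 → ℝ) :
    (aa.1 + crossProduct aa.2 p) ⬝ᵥ (u - ![0, 0, -g]) =
      (aa.1 + crossProduct aa.2 p) ⬝ᵥ u - g * slackness aa p := by
  simp [slackness, cross_apply, dotProduct, Fin.sum_univ_three]
  ring

/-- An acceleration set containing a neighborhood of the origin forces positive slackness. -/
theorem slackness_pos_of_comAccelSet_mem_nhds {A : Finset ((Fin 3 → ℝ) × (Fin 3 → ℝ))} {g : ℝ}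
    (hg : 0 < g) {p : Fin 3 → ℝ} (h : comAccelSet A g p ∈ nhds 0)
    {aa : (Fin 3 → ℝ) × (Fin 3 → ℝ)} (haa : aa ∈ A) (hnz : aa.1 + crossProduct aa.2 p ≠ 0) :
    0 < slackness aa p := by
  set v := aa.1 + crossProduct aa.2 p with hv
  have hcont : Filter.Tendsto (fun t : ℝ => t • v) (nhdsWithin 0 (Set.Ioi 0)) (nhds 0) := by
    have : Continuous fun t : ℝ => t • v := by fun_prop
    exact (this.tendsto' 0 0 (zero_smul ℝ v)).mono_left nhdsWithin_le_nhds
  obtain ⟨t, ht, htpos⟩ := ((hcont.eventually h).and self_mem_nhdsWithin).exists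
  have hle := ht aa haa
  rw [dotProduct_sub_gravity, ← hv, dotProduct_smul, smul_eq_mul] at hle
  have hvv : 0 < v ⬝ᵥ v :=
    lt_of_le_of_ne (Finset.sum_nonneg fun i _ => mul_self_nonneg (v i))
      (Ne.symm (mt dotProduct_self_eq_zero.mp hnz))
  have hprod : 0 < t * (v ⬝ᵥ v) := mul_pos htpos hvv
  exact pos_of_mul_pos_right (by linarith : 0 < g * slackness aa p) hg.le

/-- Positive slackness makes the constraints strict, hence open, at the origin. -/
theorem comAccelSet_mem_nhds_of_slackness_pos {A : Finset ((Fin 3 → ℝ) × (Fin 3 → ℝ))} {g : ℝ}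
    (hg : 0 < g) {p : Fin 3 → ℝ} (h : ∀ aa ∈ A, 0 < slackness aa p) :
    comAccelSet A g p ∈ nhds 0 := by
  refine (Filter.eventually_all_finset A).mpr fun aa haa => ?_
  simp only [dotProduct_sub_gravity, sub_nonpos]
  have hcont : Continuous fun u : Fin 3 → ℝ => (aa.1 + crossProduct aa.2 p) ⬝ᵥ u := by
    fun_prop
  exact (hcont.tendsto' 0 0 (dotProduct_zero _)).eventually_le_const (mul_pos hg (h aa haa))

/-- Proposition 1 of the paper: assuming `a_O + a × p ≠ 0` for every dual
twist in `A`, the COM lies in the interior of the static-equilibrium polygon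
(`σ_â(p) > 0` for all `â ∈ A`) if and only if the set of feasible COM
accelerations `C(p)` contains a neighborhood of the origin. -/
theorem interior_static_equilibrium_iff_accel_neighborhood
    (A : Finset ((Fin 3 → ℝ) × (Fin 3 → ℝ))) (g : ℝ) (hg : 0 < g)
    (p : Fin 3 → ℝ)
    (hnz : ∀ aa ∈ A, aa.1 + crossProduct aa.2 p ≠ 0) :
    (∀ aa ∈ A, 0 < slackness aa p) ↔
      ∃ ε > 0, Metric.ball (0 : Fin 3 → ℝ) ε ⊆ comAccelSet A g p := by
  rw [← Metric.mem_nhds_iff]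
  exact ⟨comAccelSet_mem_nhds_of_slackness_pos hg,
    fun h aa haa => slackness_pos_of_comAccelSet_mem_nhds hg h haa (hnz aa haa)⟩
end

section
/- (Proposition 2 of the paper.) Trajectory-wide acceleration cone via vertex intersection: let A be a finite set of pairs (a_O, a) ∈ ℝ³ × ℝ³, g > 0, ĝ = (0, 0, −g), and let V = {ν₁, …, ν_q} be a nonempty finite subset of ℝ³ with convex hull 𝒯 = conv(V). Then ⋂_{p ∈ 𝒯} C(p) = ⋂_{j=1}^{q} C(ν_j); that is, a COM acceleration is feasible at every point of the polytope 𝒯 if and only if it is feasible at every vertex of 𝒯. -/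
open Matrix

/-- The set of COM positions at which a given acceleration is contact-stable is convex. -/
theorem convex_setOf_mem_comAccelSet (A : Finset ((Fin 3 → ℝ) × (Fin 3 → ℝ))) (g : ℝ)
    (u : Fin 3 → ℝ) : Convex ℝ {p | u ∈ comAccelSet A g p} := by
  intro p hp q hq s t hs ht hst aa haa
  have key : (aa.1 + crossProduct aa.2 (s • p + t • q)) ⬝ᵥ (u - ![0, 0, -g]) =
      s * ((aa.1 + crossProduct aa.2 p) ⬝ᵥ (u - ![0, 0, -g])) +
        t * ((aa.1 + crossProduct aa.2 q) ⬝ᵥ (u - ![0, 0, -g])) := by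
    simp only [map_add, map_smul, add_dotProduct, smul_dotProduct, smul_eq_mul]
    linear_combination (-(aa.1 ⬝ᵥ (u - ![0, 0, -g]))) * hst
  rw [key]
  exact add_nonpos (mul_nonpos_of_nonneg_of_nonpos hs (hp aa haa))
    (mul_nonpos_of_nonneg_of_nonpos ht (hq aa haa))

/-- Proposition 2 of the paper: for a polytope `𝒯 = conv(V)` with nonempty
finite vertex set `V`, a COM acceleration is feasible at every point of `𝒯`
if and only if it is feasible at every vertex of `𝒯`:
`⋂_{p ∈ 𝒯} C(p) = ⋂_{v ∈ V} C(v)`. -/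
theorem trajectory_wide_cone_eq_vertex_intersection
    (A : Finset ((Fin 3 → ℝ) × (Fin 3 → ℝ))) (g : ℝ) (hg : 0 < g)
    (V : Finset (Fin 3 → ℝ)) (hV : V.Nonempty) :
    ⋂ p ∈ convexHull ℝ (V : Set (Fin 3 → ℝ)), comAccelSet A g p =
      ⋂ v ∈ V, comAccelSet A g v := by
  ext u
  simp only [Set.mem_iInter]
  exact ⟨fun h v hv => h v (subset_convexHull ℝ _ hv), fun h p hp =>
    convexHull_min h (convex_setOf_mem_comAccelSet A g u) hp⟩
end

section
/- Pendular ZMP support area as a cross-section of the acceleration cone: let a_O, a ∈ ℝ³, p_G = (x_G, y_G, z_G) ∈ ℝ³, g > 0, ĝ = (0, 0, −g), h > 0, and x_Z, y_Z ∈ ℝ. Set u := ((g/h)(x_Z − x_G), (g/h)(y_Z − y_G), 0). Then (a_O + a × p_G) ⬝ (u − ĝ) ≤ 0 if and only if a_i (x_Z − x_G) + b_i (y_Z − y_G) ≤ h σ, where σ := −a_{Oz} + a_y x_G − a_x y_G, a_i := a_{Ox} + a_y z_G − a_z y_G, and b_i := a_{Oy} − a_x z_G + a_z x_G. Hence the pendular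 ZMP support area coincides, under the affine correspondence (x_Z, y_Z) = (x_G, y_G) + (h/g)(u_x, u_y), with the horizontal cross-section of the feasible COM-acceleration set at zero vertical acceleration. -/
open Matrix

/-- Pendular ZMP support area as a cross-section of the acceleration cone:
with `u = ((g/h)(x_Z − x_G), (g/h)(y_Z − y_G), 0)` and `ĝ = (0,0,−g)`, the
constraint `(a_O + a × p_G) ⬝ (u − ĝ) ≤ 0` holds if and only if
`a_i (x_Z − x_G) + b_i (y_Z − y_G) ≤ h σ`, where
`σ := −a_{Oz} + a_y x_G − a_x y_G`, `a_i := a_{Ox} + a_y z_G − a_z y_G`,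
`b_i := a_{Oy} − a_x z_G + a_z x_G`. -/
theorem pendular_zmp_area_is_cone_cross_section
    (aO a pG : Fin 3 → ℝ) (g h xZ yZ : ℝ) (hg : 0 < g) (hh : 0 < h) :
    let u : Fin 3 → ℝ := ![g / h * (xZ - pG 0), g / h * (yZ - pG 1), 0]
    let gvec : Fin 3 → ℝ := ![0, 0, -g]
    let σ : ℝ := -aO 2 + a 1 * pG 0 - a 0 * pG 1
    let ai : ℝ := aO 0 + a 1 * pG 2 - a 2 * pG 1
    let bi : ℝ := aO 1 - a 0 * pG 2 + a 2 * pG 0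
    ((aO + crossProduct a pG) ⬝ᵥ (u - gvec) ≤ 0 ↔
      ai * (xZ - pG 0) + bi * (yZ - pG 1) ≤ h * σ) := by
  intro u gvec σ ai bi
  have key : (aO + crossProduct a pG) ⬝ᵥ (u - gvec) =
      g / h * (ai * (xZ - pG 0) + bi * (yZ - pG 1) - h * σ) := by
    simp [u, gvec, σ, ai, bi, cross_apply, dotProduct, Fin.sum_univ_three]
    field_simp
    ring
  rw [key, ← sub_nonpos (b := h * σ)]
  exact mul_nonpos_iff_pos_imp_nonpos.trans
    ⟨fun H => H.1 (div_pos hg hh), fun H => ⟨fun _ => H, fun _ => (div_pos hg hh).le⟩⟩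
end

section
/- Irresistible direction on the boundary of the static-equilibrium polygon: let A be a finite set of pairs (a_O, a) ∈ ℝ³ × ℝ³, g > 0, ĝ = (0, 0, −g), and p = (x, y, z) ∈ ℝ³. Suppose â = (a_O, a) ∈ A satisfies σ_â(p) = 0 (the COM lies on the corresponding supporting line of the static-equilibrium polygon). Then every u = (u_x, u_y, u_z) ∈ C(p) satisfies a_i(â, p) u_x + b_i(â, p) u_y ≤ 0; equivalently, setting d := (−a_i(â,p), −b_i(â,p), 0), every feasible COM acceleration u ∈ C(p) satisfies d ⬝ u ≥ 0. -/
open Matrix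

/-- The contact constraint of a dual twist at `p`, split into its horizontal coefficients and
its slackness. -/
theorem dotProduct_sub_gravity_eq (aa : (Fin 3 → ℝ) × (Fin 3 → ℝ)) (p u : Fin 3 → ℝ) (g : ℝ) :
    (aa.1 + crossProduct aa.2 p) ⬝ᵥ (u - ![0, 0, -g]) =
      acoef aa p * u 0 + bcoef aa p * u 1 - slackness aa p * (u 2 + g) := by
  simp only [acoef, bcoef, slackness, cross_apply, vec3_dotProduct, Pi.add_apply, Pi.sub_apply,
    cons_val]
  ring

/-- Irresistible direction on the boundary of the static-equilibrium polygon: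
if `â ∈ A` satisfies `σ_â(p) = 0`, then every feasible acceleration
`u ∈ C(p)` satisfies `a_i(â,p) u_x + b_i(â,p) u_y ≤ 0`; equivalently, with
`d := (−a_i(â,p), −b_i(â,p), 0)`, every `u ∈ C(p)` satisfies `d ⬝ u ≥ 0`. -/
theorem irresistible_direction_on_boundary
    (A : Finset ((Fin 3 → ℝ) × (Fin 3 → ℝ))) (g : ℝ) (hg : 0 < g)
    (p : Fin 3 → ℝ) (aa : (Fin 3 → ℝ) × (Fin 3 → ℝ)) (haa : aa ∈ A)
    (hσ : slackness aa p = 0) :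
    ∀ u ∈ comAccelSet A g p,
      acoef aa p * u 0 + bcoef aa p * u 1 ≤ 0 ∧
      0 ≤ (![-acoef aa p, -bcoef aa p, 0] : Fin 3 → ℝ) ⬝ᵥ u := by
  intro u hu
  have key : acoef aa p * u 0 + bcoef aa p * u 1 ≤ 0 := by
    have h := hu aa haa
    rwa [dotProduct_sub_gravity_eq, hσ, zero_mul, sub_zero] at h
  refine ⟨key, ?_⟩
  simp only [vec3_dotProduct, cons_val]
  linarith
end
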